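/- arXiv:1210.7628 — 2 statements merged into one kernel-verified Lean document; each statement's English description precedes it below -/
import Mathlib

section
/- Let $\tau_1,\tau_2$ be two Schrödinger-type expressions ($p_j=r_j=1$) with distributional potentials on intervals $(a,b_j)$ sharing the left endpoint $a$, with coefficients $q_j,s_j\in L^1_{loc}$. For $c\in(a,b_1)\cap(a,b_2)$, the following are equivalent: (i) $\tau_1$ and $\tau_2$ coincide on $(a,c)$ (same domain and action when restricted to $(a,c)$); (ii) for $j,k\in\{1,2\}$ there are solutions $u_{j,k}$ of $(\tau_j - z_k)u=0$ with $u_{1,k}=u_{2,k}$ on $(a,c)$ and such that $u_{j,1},u_{j,2}$ have no common zero in $(a,c)$; (iii) $s_1 - s_2$ is locally absolutely continuous on $(a,c)$ and $(s_1-s_2)' = s_1^2 - s_2^2 + q_1 - q_2$ a.e. on $(a,c)$. -/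
open MeasureTheory Set Filter Complex Topology ComplexConjugate

noncomputable section

/-- `f` is locally absolutely continuous on `(a,b)` with a.e. derivative `g`,
encoded via the integral representation. -/
def HasACDeriv (a b : ℝ) (f g : ℝ → ℂ) : Prop :=
  ∀ x ∈ Set.Ioo a b, ∀ y ∈ Set.Ioo a b,
    IntervalIntegrable g volume y x ∧ f x = f y + ∫ t in y..x, g t

/-- `f` lies in the domain `𝔇_τ` with first quasi-derivative `fq = p (f' + s f)` and
`τ f = w`, encoded via the equivalent first order system
`(f, f^{[1]})' = ((-s, 1/p), (q - 0·r, s)) (f, f^{[1]}) - (0, r·w)`. -/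
structure SLSys (a b : ℝ) (p q r s : ℝ → ℝ) (f fq w : ℝ → ℂ) : Prop where
  fst : HasACDeriv a b f fun x => fq x / (p x : ℂ) - (s x : ℂ) * f x
  snd : HasACDeriv a b fq fun x => (s x : ℂ) * fq x + (q x : ℂ) * f x - (r x : ℂ) * w x

/-- Standing hypothesis on the coefficients `p, q, r, s` on `(a,b)`:
real-valued and measurable, `p⁻¹, q, r, s ∈ L¹_loc((a,b))`, `p ≠ 0` and `r > 0` a.e. -/
structure SLHyp (a b : ℝ) (p q r s : ℝ → ℝ) : Prop where
  lt : a < b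
  mp : Measurable p
  mq : Measurable q
  mr : Measurable r
  ms : Measurable s
  ip : ∀ x ∈ Set.Ioo a b, ∀ y ∈ Set.Ioo a b,
    IntervalIntegrable (fun t => (p t)⁻¹) volume y x
  iq : ∀ x ∈ Set.Ioo a b, ∀ y ∈ Set.Ioo a b, IntervalIntegrable q volume y x
  ir : ∀ x ∈ Set.Ioo a b, ∀ y ∈ Set.Ioo a b, IntervalIntegrable r volume y x
  is' : ∀ x ∈ Set.Ioo a b, ∀ y ∈ Set.Ioo a b, IntervalIntegrable s volume y x
  pne : ∀ᵐ t ∂(volume.restrict (Set.Ioo a b)), p t ≠ 0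
  rpos : ∀ᵐ t ∂(volume.restrict (Set.Ioo a b)), 0 < r t

/-- The modified Wronskian `W(f,g)(x) = f(x) g^{[1]}(x) - f^{[1]}(x) g(x)`. -/
def Wr (f fq g gq : ℝ → ℂ) (x : ℝ) : ℂ := f x * gq x - fq x * g x

theorem ac_of_dist_le {X Y : Type*} [PseudoMetricSpace X] [PseudoMetricSpace Y]
    {f : ℝ → X} {g : ℝ → Y} {y x K : ℝ}
    (hf : AbsolutelyContinuousOnInterval f y x)
    (h : ∀ u ∈ uIcc y x, ∀ v ∈ uIcc y x, dist (g u) (g v) ≤ K * dist (f u) (f v)) :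
    AbsolutelyContinuousOnInterval g y x := by
  have h2 := Filter.Tendsto.const_mul K (show Tendsto _ _ _ from hf)
  simp only [mul_zero] at h2
  refine squeeze_zero' ?_ ?_ h2
  · exact Eventually.of_forall fun _ => Finset.sum_nonneg fun _ _ => dist_nonneg
  · have : AbsolutelyContinuousOnInterval.disjWithin y x ∈
      (AbsolutelyContinuousOnInterval.totalLengthFilter ⊓
        𝓟 (AbsolutelyContinuousOnInterval.disjWithin y x)) :=
      mem_inf_of_right (mem_principal_self _)
    filter_upwards [this] with E hE
    rw [Finset.mul_sum]
    exact Finset.sum_le_sum fun i hi => h _ (hE.1 i hi).1 _ (hE.1 i hi).2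

theorem uIcc_sub_Ioo {a b x y : ℝ} (hx : x ∈ Ioo a b) (hy : y ∈ Ioo a b) :
    uIcc y x ⊆ Ioo a b := ordConnected_Ioo.uIcc_subset hy hx

theorem ac_integral {g : ℝ → ℂ} {y x : ℝ} (hg : IntervalIntegrable g volume y x) :
    AbsolutelyContinuousOnInterval (fun u => ∫ t in y..u, g t) y x := by
  have hre : IntervalIntegrable (fun t => (g t).re) volume y x :=
    ⟨hg.1.re, hg.2.re⟩
  have him : IntervalIntegrable (fun t => (g t).im) volume y x :=
    ⟨hg.1.im, hg.2.im⟩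
  have h1 := hre.absolutelyContinuousOnInterval_intervalIntegral (c := y) left_mem_uIcc
  have h2 := him.absolutelyContinuousOnInterval_intervalIntegral (c := y) left_mem_uIcc
  have h1' : AbsolutelyContinuousOnInterval (fun u => ((∫ t in y..u, (g t).re : ℝ) : ℂ)) y x :=
    ac_of_dist_le (K := 1) h1 (fun u _ v _ => by
      rw [one_mul, Complex.dist_eq, ← ofReal_sub, Complex.norm_real, Real.dist_eq]; rfl)
  have h2' : AbsolutelyContinuousOnInterval
      (fun u => ((∫ t in y..u, (g t).im : ℝ) : ℂ)) y x :=
    ac_of_dist_le (K := 1) h2 (fun u _ v _ => by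
      rw [one_mul, Complex.dist_eq, ← ofReal_sub, Complex.norm_real, Real.dist_eq]; rfl)
  have h3 := h1'.add (h2'.const_smul Complex.I)
  refine ac_of_dist_le (K := 1) h3 fun u hu v hv => ?_
  have key : ∀ u ∈ uIcc y x, (∫ t in y..u, g t) =
      ((∫ t in y..u, (g t).re : ℝ) : ℂ) + Complex.I • ((∫ t in y..u, (g t).im : ℝ) : ℂ) := by
    intro u hu
    have hs : uIcc y u ⊆ uIcc y x := uIcc_subset_uIcc left_mem_uIcc hu
    rw [← intervalIntegral.integral_ofReal, ← intervalIntegral.integral_ofReal,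
      ← intervalIntegral.integral_smul, ← intervalIntegral.integral_add]
    · refine intervalIntegral.integral_congr fun t _ => ?_
      simp only [smul_eq_mul]
      rw [mul_comm, re_add_im]
    · exact ⟨(hre.mono_set hs).1.ofReal, (hre.mono_set hs).2.ofReal⟩
    · have h4 : IntervalIntegrable (fun t => ((g t).im : ℂ)) volume y u :=
        ⟨(him.mono_set hs).1.ofReal, (him.mono_set hs).2.ofReal⟩
      exact h4.smul Complex.I
  simp only [Pi.add_apply]
  rw [key u hu, key v hv, one_mul]

structure ACD (a b : ℝ) (f g : ℝ → ℂ) : Prop where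
  ac : ∀ x ∈ Ioo a b, ∀ y ∈ Ioo a b, AbsolutelyContinuousOnInterval f y x
  int : ∀ x ∈ Ioo a b, ∀ y ∈ Ioo a b, IntervalIntegrable g volume y x
  der : ∀ᵐ t, t ∈ Ioo a b → HasDerivAt f (g t) t

theorem ae_Ioo_of {a b : ℝ} {P : ℝ → Prop}
    (h : ∀ x ∈ Ioo a b, ∀ y ∈ Ioo a b, ∀ᵐ t, t ∈ uIcc y x → P t) :
    ∀ᵐ t, t ∈ Ioo a b → P t := by
  have h1 : ∀ᵐ t : ℝ, ∀ p q : ℚ, (p : ℝ) ∈ Ioo a b → (q : ℝ) ∈ Ioo a b →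
      t ∈ uIcc (p : ℝ) q → P t := by
    rw [ae_all_iff]; intro p
    rw [ae_all_iff]; intro q
    by_cases hp : (p : ℝ) ∈ Ioo a b
    · by_cases hq : (q : ℝ) ∈ Ioo a b
      · filter_upwards [h q hq p hp] with t ht _ _ using ht
      · exact Eventually.of_forall fun t _ h => absurd h hq
    · exact Eventually.of_forall fun t h => absurd h hp
  filter_upwards [h1] with t ht hm
  obtain ⟨p, hp1, hp2⟩ := exists_rat_btwn hm.1
  obtain ⟨q, hq1, hq2⟩ := exists_rat_btwn hm.2
  refine ht p q ⟨hp1, hp2.trans hm.2⟩ ⟨hm.1.trans hq1, hq2⟩ ?_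
  rw [uIcc_of_le (hp2.trans hq1).le]
  exact ⟨hp2.le, hq1.le⟩

theorem HasACDeriv.acd {a b : ℝ} {f g : ℝ → ℂ} (h : HasACDeriv a b f g) : ACD a b f g where
  ac x hx y hy := by
    refine ac_of_dist_le (K := 1) (ac_integral (h x hx y hy).1) fun u hu v hv => ?_
    rw [(h u (uIcc_sub_Ioo hx hy hu) y hy).2, (h v (uIcc_sub_Ioo hx hy hv) y hy).2, one_mul,
      dist_add_left]
  int x hx y hy := (h x hx y hy).1
  der := by
    refine ae_Ioo_of fun x hx y hy => ?_
    filter_upwards [(h x hx y hy).1.ae_hasDerivAt_integral] with t ht hm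
    have h1 := (ht hm y left_mem_uIcc).const_add (f y)
    refine h1.congr_of_eventuallyEq ?_
    filter_upwards [isOpen_Ioo.mem_nhds (uIcc_sub_Ioo hx hy hm)] with u hu
    exact (h u hu y hy).2

theorem ACD.has {a b : ℝ} {f g : ℝ → ℂ} (h : ACD a b f g) : HasACDeriv a b f g := by
  intro x hx y hy
  refine ⟨h.int x hx y hy, ?_⟩
  have hi := h.int x hx y hy
  have hac := (h.ac x hx y hy).sub (ac_integral hi)
  obtain ⟨C, hC⟩ := hac.const_of_ae_hasDerivAt_zero (by
    filter_upwards [h.der, hi.ae_hasDerivAt_integral] with t h1 h2 hm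
    have := (h1 (uIcc_sub_Ioo hx hy hm)).sub (h2 hm y left_mem_uIcc)
    simpa using this)
  have e1 := hC y left_mem_uIcc
  have e2 := hC x right_mem_uIcc
  simp only [Pi.sub_apply, intervalIntegral.integral_same] at e1 e2
  linear_combination e2 - e1

namespace ACD
variable {a b : ℝ} {f f' g g' : ℝ → ℂ}

theorem continuousOn (h : ACD a b f f') : ContinuousOn f (Ioo a b) := by
  intro t ht
  obtain ⟨p, hp1, hp2⟩ := exists_between ht.1
  obtain ⟨q, hq1, hq2⟩ := exists_between ht.2
  have h1 := (h.ac q ⟨ht.1.trans hq1, hq2⟩ p ⟨hp1, hp2.trans ht.2⟩).continuousOn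
  rw [uIcc_of_le (hp2.trans hq1).le] at h1
  exact (h1.continuousAt (Icc_mem_nhds hp2 hq1)).continuousWithinAt

theorem contSub (h : ACD a b f f') {x y : ℝ} (hx : x ∈ Ioo a b) (hy : y ∈ Ioo a b) :
    ContinuousOn f (uIcc y x) := h.continuousOn.mono (uIcc_sub_Ioo hx hy)

theorem add (hf : ACD a b f f') (hg : ACD a b g g') :
    ACD a b (fun x => f x + g x) (fun x => f' x + g' x) where
  ac x hx y hy := (hf.ac x hx y hy).add (hg.ac x hx y hy)
  int x hx y hy := (hf.int x hx y hy).add (hg.int x hx y hy)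
  der := by
    filter_upwards [hf.der, hg.der] with t h1 h2 hm using (h1 hm).add (h2 hm)

theorem sub (hf : ACD a b f f') (hg : ACD a b g g') :
    ACD a b (fun x => f x - g x) (fun x => f' x - g' x) where
  ac x hx y hy := (hf.ac x hx y hy).sub (hg.ac x hx y hy)
  int x hx y hy := (hf.int x hx y hy).sub (hg.int x hx y hy)
  der := by
    filter_upwards [hf.der, hg.der] with t h1 h2 hm using (h1 hm).sub (h2 hm)

theorem mul (hf : ACD a b f f') (hg : ACD a b g g') :
    ACD a b (fun x => f x * g x) (fun x => f' x * g x + f x * g' x) where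
  ac x hx y hy := (hf.ac x hx y hy).smul (hg.ac x hx y hy)
  int x hx y hy := ((hf.int x hx y hy).mul_continuousOn (hg.contSub hx hy)).add
    ((hg.int x hx y hy).continuousOn_mul (hf.contSub hx hy))
  der := by
    filter_upwards [hf.der, hg.der] with t h1 h2 hm using (h1 hm).mul (h2 hm)

theorem const (z : ℂ) : ACD a b (fun _ => z) (fun _ => 0) where
  ac x _ y _ := (LipschitzWith.const z).lipschitzOnWith.absolutelyContinuousOnInterval
  int x _ y _ := by simp
  der := Eventually.of_forall fun t _ => hasDerivAt_const _ _

theorem star (hf : ACD a b f f') : ACD a b (fun x => conj (f x)) (fun x => conj (f' x)) where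
  ac x hx y hy := ac_of_dist_le (K := 1) (hf.ac x hx y hy) fun u _ v _ => by
    rw [one_mul, Complex.dist_conj_conj]
  int x hx y hy := by
    have := hf.int x hx y hy
    rw [intervalIntegrable_iff] at this ⊢
    exact (Complex.conjCLE : ℂ →L[ℝ] ℂ).integrable_comp this
  der := by
    filter_upwards [hf.der] with t h1 hm
    exact (Complex.conjCLE : ℂ →L[ℝ] ℂ).hasFDerivAt.comp_hasDerivAt t (h1 hm)

theorem inv (hf : ACD a b f f') (h0 : ∀ x ∈ Ioo a b, f x ≠ 0) :
    ACD a b (fun x => (f x)⁻¹) (fun x => - f' x * ((f x)⁻¹ * (f x)⁻¹)) where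
  ac x hx y hy := by
    have hc : ContinuousOn (fun x => (f x)⁻¹) (uIcc y x) :=
      (hf.contSub hx hy).inv₀ fun t ht => h0 t (uIcc_sub_Ioo hx hy ht)
    obtain ⟨C, hC⟩ := isCompact_uIcc.exists_bound_of_continuousOn hc
    refine ac_of_dist_le (K := C * C) (hf.ac x hx y hy) fun u hu v hv => ?_
    have hu0 := h0 u (uIcc_sub_Ioo hx hy hu)
    have hv0 := h0 v (uIcc_sub_Ioo hx hy hv)
    have : (f u)⁻¹ - (f v)⁻¹ = (f u)⁻¹ * (f v)⁻¹ * (f v - f u) := by field_simp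
    rw [dist_eq_norm, this, norm_mul, norm_mul, dist_comm, dist_eq_norm]
    have hC0 : 0 ≤ C := (norm_nonneg _).trans (hC u hu)
    gcongr
    · exact hC u hu
    · exact hC v hv
  int x hx y hy := by
    have hc : ContinuousOn (fun x => (f x)⁻¹) (uIcc y x) :=
      (hf.contSub hx hy).inv₀ fun t ht => h0 t (uIcc_sub_Ioo hx hy ht)
    exact (hf.int x hx y hy).neg.mul_continuousOn (hc.mul hc)
  der := by
    filter_upwards [hf.der] with t h1 hm
    have := (h1 hm).inv (h0 t hm)
    convert! this using 1
    field_simp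

theorem congr (hf : ACD a b f f') (h1 : ∀ x ∈ Ioo a b, f x = g x)
    (h2 : ∀ᵐ t, t ∈ Ioo a b → f' t = g' t) : ACD a b g g' where
  ac x hx y hy := ac_of_dist_le (K := 1) (hf.ac x hx y hy) fun u hu v hv => by
    rw [one_mul, h1 u (uIcc_sub_Ioo hx hy hu), h1 v (uIcc_sub_Ioo hx hy hv)]
  int x hx y hy := by
    refine (hf.int x hx y hy).congr_ae ?_
    rw [EventuallyEq, ae_restrict_iff' measurableSet_uIoc]
    filter_upwards [h2] with t ht hm
    exact ht (uIcc_sub_Ioo hx hy (uIoc_subset_uIcc hm))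
  der := by
    filter_upwards [hf.der, h2] with t h3 h4 hm
    rw [← h4 hm]
    refine (h3 hm).congr_of_eventuallyEq ?_
    filter_upwards [isOpen_Ioo.mem_nhds hm] with u hu using (h1 u hu).symm

theorem uniq (hf : ACD a b f f') (hg : ACD a b g g') (h : ∀ x ∈ Ioo a b, f x = g x) :
    ∀ᵐ t, t ∈ Ioo a b → f' t = g' t := by
  filter_upwards [hf.der, hg.der] with t h1 h2 hm
  refine (h1 hm).unique ((h2 hm).congr_of_eventuallyEq ?_)
  filter_upwards [isOpen_Ioo.mem_nhds hm] with u hu using h u hu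

theorem mono (hf : ACD a b f f') {c : ℝ} (hc : c ≤ b) : ACD a c f f' where
  ac x hx y hy := hf.ac x ⟨hx.1, hx.2.trans_le hc⟩ y ⟨hy.1, hy.2.trans_le hc⟩
  int x hx y hy := hf.int x ⟨hx.1, hx.2.trans_le hc⟩ y ⟨hy.1, hy.2.trans_le hc⟩
  der := by
    filter_upwards [hf.der] with t h hm using h ⟨hm.1, hm.2.trans_le hc⟩

theorem const_of_zero (hf : ACD a b f f') (h : ∀ᵐ t, t ∈ Ioo a b → f' t = 0) :
    ∀ x ∈ Ioo a b, ∀ y ∈ Ioo a b, f x = f y := by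
  have h2 : ACD a b f (fun _ => 0) := hf.congr (fun _ _ => rfl) h
  intro x hx y hy
  have := (h2.has x hx y hy).2
  simpa using this

end ACD

theorem sinh_bound {a b x₀ : ℝ} {m : ℝ → ℝ}
    (hm : ∀ x ∈ Ioo a b, ∀ y ∈ Ioo a b, IntervalIntegrable m volume y x)
    (hx₀ : x₀ ∈ Ioo a b) {x : ℝ} (hx : x ∈ Ioo a b) :
    ∫ t in x₀..x, 2 * m t * Real.cosh (2 * ∫ r in x₀..t, m r) =
      Real.sinh (2 * ∫ r in x₀..x, m r) := by
  have hi := hm x hx x₀ hx₀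
  have hM := hi.absolutelyContinuousOnInterval_intervalIntegral (c := x₀) left_mem_uIcc
  obtain ⟨C, hC⟩ := hM.exists_bound
  have hφ : ContDiffOn ℝ 1 (fun y : ℝ => Real.sinh (2 * y)) (Icc (-C) C) := by fun_prop
  obtain ⟨K, hK⟩ := hφ.exists_lipschitzOnWith one_ne_zero (convex_Icc _ _) isCompact_Icc
  have hac : AbsolutelyContinuousOnInterval
      (fun x => Real.sinh (2 * ∫ r in x₀..x, m r)) x₀ x :=
    ac_of_dist_le hM fun u hu v hv =>
      hK.dist_le_mul _ (abs_le.1 (hC u hu)) _ (abs_le.1 (hC v hv))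
  have h1 := hac.integral_deriv_eq_sub
  simp only [intervalIntegral.integral_same, mul_zero, Real.sinh_zero, sub_zero] at h1
  rw [← h1]
  refine intervalIntegral.integral_congr_ae ?_
  filter_upwards [hi.ae_hasDerivAt_integral] with t ht hmem
  have h2 := ((ht (uIoc_subset_uIcc hmem) x₀ left_mem_uIcc).const_mul 2).sinh
  rw [h2.deriv]; ring

theorem primitive_contOn {E : Type*} [NormedAddCommGroup E] [NormedSpace ℝ E]
    {a b x₀ : ℝ} {m : ℝ → E}
    (hm : ∀ x ∈ Ioo a b, ∀ y ∈ Ioo a b, IntervalIntegrable m volume y x)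
    (hx₀ : x₀ ∈ Ioo a b) : ContinuousOn (fun x => ∫ r in x₀..x, m r) (Ioo a b) := by
  intro t ht
  obtain ⟨p, hp1, hp2⟩ := exists_between (lt_min ht.1 hx₀.1)
  obtain ⟨q, hq1, hq2⟩ := exists_between (max_lt ht.2 hx₀.2)
  rw [lt_min_iff] at hp2
  rw [max_lt_iff] at hq1
  have hpq : p ≤ q := (hp2.1.trans hq1.1).le
  have h1 := intervalIntegral.continuousOn_primitive_interval' (a := x₀)
    (hm q ⟨ht.1.trans hq1.1, hq2⟩ p ⟨hp1, hp2.1.trans ht.2⟩)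
    (by rw [uIcc_of_le hpq]; exact ⟨hp2.2.le, hq1.2.le⟩)
  rw [uIcc_of_le hpq] at h1
  exact (h1.continuousAt (Icc_mem_nhds hp2.1 hq1.1)).continuousWithinAt

open scoped Classical in
theorem exists_ode {E : Type*} [NormedAddCommGroup E] [NormedSpace ℝ E] [CompleteSpace E]
    {a b x₀ : ℝ} {m : ℝ → ℝ} (V : ℝ → E → E)
    (hm0 : ∀ t, 0 ≤ m t)
    (hm : ∀ x ∈ Ioo a b, ∀ y ∈ Ioo a b, IntervalIntegrable m volume y x)
    (hVsub : ∀ t y z, V t y - V t z = V t (y - z))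
    (hVb : ∀ t y, ‖V t y‖ ≤ m t * ‖y‖)
    (hVi : ∀ Y : ℝ → E, ContinuousOn Y (Ioo a b) → ∀ x ∈ Ioo a b, ∀ y ∈ Ioo a b,
      IntervalIntegrable (fun t => V t (Y t)) volume y x)
    (hx₀ : x₀ ∈ Ioo a b) (y₀ : E) :
    ∃ Y : ℝ → E, ContinuousOn Y (Ioo a b) ∧
      ∀ x ∈ Ioo a b, Y x = y₀ + ∫ t in x₀..x, V t (Y t) := by
  set w : ℝ → ℝ := fun x => Real.cosh (2 * ∫ r in x₀..x, m r) with hw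
  have hw1 : ∀ x, 1 ≤ w x := fun x => Real.one_le_cosh _
  have hw0 : ∀ x, 0 < w x := fun x => lt_of_lt_of_le one_pos (hw1 x)
  have hMc := primitive_contOn hm hx₀
  have hwc : ContinuousOn w (Ioo a b) :=
    Real.continuous_cosh.comp_continuousOn (continuousOn_const.mul hMc)
  have hmw : ∀ x ∈ Ioo a b, IntervalIntegrable (fun t => m t * w t) volume x₀ x := fun x hx =>
    (hm x hx x₀ hx₀).mul_continuousOn (hwc.mono (uIcc_sub_Ioo hx hx₀))
  have hkey : ∀ x ∈ Ioo a b, |∫ t in x₀..x, m t * w t| ≤ w x / 2 := by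
    intro x hx
    have h1 := sinh_bound hm hx₀ hx
    have h2 : ∫ t in x₀..x, m t * w t = Real.sinh (2 * ∫ r in x₀..x, m r) / 2 := by
      rw [← h1, ← intervalIntegral.integral_div]
      refine intervalIntegral.integral_congr fun t _ => ?_
      simp only [hw]; ring
    rw [h2, abs_div, abs_two]
    gcongr
    simp only [hw]
    rw [Real.abs_sinh, ← Real.cosh_abs]
    exact (Real.sinh_lt_cosh _).le
  -- the estimate
  have hest : ∀ (Y : ℝ → E) (C : ℝ), 0 ≤ C → (∀ t ∈ Ioo a b, ‖Y t‖ ≤ C * w t) →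
      ∀ x ∈ Ioo a b, ‖∫ t in x₀..x, V t (Y t)‖ ≤ C * w x / 2 := by
    intro Y C hC hY x hx
    have h1 : ‖∫ t in x₀..x, V t (Y t)‖ ≤ |∫ t in x₀..x, C * (m t * w t)| := by
      refine intervalIntegral.norm_integral_le_abs_of_norm_le ?_ ((hmw x hx).const_mul C)
      rw [ae_restrict_iff' measurableSet_uIoc]
      refine Eventually.of_forall fun t ht => (hVb _ _).trans ?_
      have := hY t (uIcc_sub_Ioo hx hx₀ (uIoc_subset_uIcc ht))
      calc m t * ‖Y t‖ ≤ m t * (C * w t) := mul_le_mul_of_nonneg_left this (hm0 t)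
        _ = C * (m t * w t) := by ring
    rw [intervalIntegral.integral_const_mul, abs_mul, abs_of_nonneg hC] at h1
    calc _ ≤ _ := h1
      _ ≤ C * (w x / 2) := mul_le_mul_of_nonneg_left (hkey x hx) hC
      _ = _ := by ring
  let ext : BoundedContinuousFunction (Ioo a b) E → ℝ → E := fun Z t =>
    if h : t ∈ Ioo a b then w t • Z ⟨t, h⟩ else 0
  have hext : ∀ Z t (h : t ∈ Ioo a b), ext Z t = w t • Z ⟨t, h⟩ := fun Z t h => dif_pos h
  have hextc : ∀ Z, ContinuousOn (ext Z) (Ioo a b) := by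
    intro Z
    rw [continuousOn_iff_continuous_domRestrict]
    have : (Ioo a b).domRestrict (ext Z) = fun t : Ioo a b => w t • Z t := by
      funext t; exact hext Z t t.2
    rw [this]
    exact (continuousOn_iff_continuous_domRestrict.1 hwc).smul Z.continuous
  have hTc : ∀ Z, Continuous (fun x : Ioo a b =>
      (w x)⁻¹ • (y₀ + ∫ t in x₀..(x : ℝ), V t (ext Z t))) := by
    intro Z
    have h1 := primitive_contOn (hVi _ (hextc Z)) hx₀
    have h2 := (hwc.inv₀ fun x _ => (hw0 x).ne').smul (continuousOn_const (c := y₀) |>.add h1)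
    exact continuousOn_iff_continuous_domRestrict.1 h2
  have hextb : ∀ Z, ∀ t ∈ Ioo a b, ‖ext Z t‖ ≤ ‖Z‖ * w t := by
    intro Z t ht
    rw [hext Z t ht, norm_smul, Real.norm_of_nonneg (hw0 t).le, mul_comm]
    exact mul_le_mul_of_nonneg_right (Z.norm_coe_le_norm _) (hw0 t).le
  have hTb : ∀ Z, ∀ x : Ioo a b,
      ‖(w x)⁻¹ • (y₀ + ∫ t in x₀..(x : ℝ), V t (ext Z t))‖ ≤ ‖y₀‖ + ‖Z‖ := by
    intro Z x
    rw [norm_smul, norm_inv, Real.norm_of_nonneg (hw0 x).le, inv_mul_le_iff₀ (hw0 x)]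
    have h1 := hest (ext Z) ‖Z‖ (norm_nonneg _) (hextb Z) x x.2
    have h2 := norm_add_le y₀ (∫ t in x₀..(x : ℝ), V t (ext Z t))
    nlinarith [norm_nonneg y₀, norm_nonneg Z, hw1 x, mul_nonneg (norm_nonneg Z) (hw0 x).le]
  let T : BoundedContinuousFunction (Ioo a b) E → BoundedContinuousFunction (Ioo a b) E :=
    fun Z => BoundedContinuousFunction.ofNormedAddCommGroup _ (hTc Z) _ (hTb Z)
  have hT : ContractingWith (1 / 2) T := by
    refine ⟨by norm_num, LipschitzWith.of_dist_le_mul fun Z Z' => ?_⟩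
    have hc : (((1 / 2 : NNReal)) : ℝ) = 1 / 2 := by norm_num
    rw [hc, BoundedContinuousFunction.dist_le (by positivity)]
    intro x
    change dist ((w x)⁻¹ • (y₀ + ∫ t in x₀..(x : ℝ), V t (ext Z t)))
      ((w x)⁻¹ • (y₀ + ∫ t in x₀..(x : ℝ), V t (ext Z' t))) ≤ _
    rw [dist_eq_norm, ← smul_sub, add_sub_add_left_eq_sub, ← intervalIntegral.integral_sub
      (hVi _ (hextc Z) x x.2 x₀ hx₀) (hVi _ (hextc Z') x x.2 x₀ hx₀)]
    simp only [hVsub]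
    rw [norm_smul, norm_inv, Real.norm_of_nonneg (hw0 x).le, inv_mul_le_iff₀ (hw0 x)]
    have h1 := hest (fun t => ext Z t - ext Z' t) ‖Z - Z'‖ (norm_nonneg _) (by
      intro t ht
      have : ext Z t - ext Z' t = ext (Z - Z') t := by
        rw [hext _ t ht, hext _ t ht, hext _ t ht, ← smul_sub]; rfl
      rw [this]; exact hextb _ t ht) x x.2
    rw [dist_eq_norm]
    linarith
  have hfix := hT.fixedPoint_isFixedPt
  set Z := hT.fixedPoint with hZ
  refine ⟨ext Z, hextc Z, fun x hx => ?_⟩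
  have h1 : T Z ⟨x, hx⟩ = Z ⟨x, hx⟩ := by rw [hfix]
  change (w x)⁻¹ • (y₀ + ∫ t in x₀..x, V t (ext Z t)) = Z ⟨x, hx⟩ at h1
  rw [hext Z x hx, ← h1, smul_smul, mul_inv_cancel₀ (hw0 x).ne', one_smul]

theorem exists_sol {a b x₀ : ℝ} {q s : ℝ → ℝ}
    (hyp : SLHyp a b (fun _ => 1) q (fun _ => 1) s) (hx₀ : x₀ ∈ Ioo a b) (y₀ y₁ : ℂ) :
    ∃ u uq, SLSys a b (fun _ => 1) q (fun _ => 1) s u uq (fun x => 0 * u x) ∧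
      u x₀ = y₀ ∧ uq x₀ = y₁ := by
  let V : ℝ → ℂ × ℂ → ℂ × ℂ := fun t y => (y.2 - s t * y.1, s t * y.2 + q t * y.1)
  have hsC : ∀ x ∈ Ioo a b, ∀ y ∈ Ioo a b, IntervalIntegrable (fun t => (s t : ℂ)) volume y x :=
    fun x hx y hy => ⟨(hyp.is' x hx y hy).1.ofReal, (hyp.is' x hx y hy).2.ofReal⟩
  have hqC : ∀ x ∈ Ioo a b, ∀ y ∈ Ioo a b, IntervalIntegrable (fun t => (q t : ℂ)) volume y x :=
    fun x hx y hy => ⟨(hyp.iq x hx y hy).1.ofReal, (hyp.iq x hx y hy).2.ofReal⟩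
  have hi1 : ∀ Y : ℝ → ℂ × ℂ, ContinuousOn Y (Ioo a b) → ∀ x ∈ Ioo a b, ∀ y ∈ Ioo a b,
      IntervalIntegrable (fun t => (Y t).2 - s t * (Y t).1) volume y x := by
    intro Y hY x hx y hy
    have hY' := hY.mono (uIcc_sub_Ioo hx hy)
    exact hY'.snd.intervalIntegrable.sub ((hsC x hx y hy).mul_continuousOn hY'.fst)
  have hi2 : ∀ Y : ℝ → ℂ × ℂ, ContinuousOn Y (Ioo a b) → ∀ x ∈ Ioo a b, ∀ y ∈ Ioo a b,
      IntervalIntegrable (fun t => s t * (Y t).2 + q t * (Y t).1) volume y x := by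
    intro Y hY x hx y hy
    have hY' := hY.mono (uIcc_sub_Ioo hx hy)
    exact ((hsC x hx y hy).mul_continuousOn hY'.snd).add
      ((hqC x hx y hy).mul_continuousOn hY'.fst)
  have hVi : ∀ Y : ℝ → ℂ × ℂ, ContinuousOn Y (Ioo a b) → ∀ x ∈ Ioo a b, ∀ y ∈ Ioo a b,
      IntervalIntegrable (fun t => V t (Y t)) volume y x := by
    intro Y hY x hx y hy
    have h1 := hi1 Y hY x hx y hy
    have h2 := hi2 Y hY x hx y hy
    rw [intervalIntegrable_iff] at h1 h2 ⊢
    exact h1.prodMk h2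
  obtain ⟨Y, hYc, hY⟩ := exists_ode (m := fun t => 1 + |s t| + |q t|) V
    (fun t => by positivity)
    (fun x hx y hy => ((_root_.intervalIntegrable_const).add (hyp.is' x hx y hy).abs).add
      (hyp.iq x hx y hy).abs)
    (fun t y z => by
      simp only [V, Prod.mk_sub_mk, Prod.fst_sub, Prod.snd_sub, Prod.mk.injEq]
      constructor <;> ring)
    (fun t y => by
      have h1 := norm_fst_le y
      have h2 := norm_snd_le y
      have hs0 := abs_nonneg (s t)
      have hq0 := abs_nonneg (q t)
      have hy0 := norm_nonneg y
      have e1 := mul_le_mul_of_nonneg_left h1 hs0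
      have e2 := mul_le_mul_of_nonneg_left h2 hs0
      have e3 := mul_le_mul_of_nonneg_left h1 hq0
      have n1 : ‖(s t : ℂ) * y.1‖ = |s t| * ‖y.1‖ := by
        rw [norm_mul, Complex.norm_real, Real.norm_eq_abs]
      have n2 : ‖(s t : ℂ) * y.2‖ = |s t| * ‖y.2‖ := by
        rw [norm_mul, Complex.norm_real, Real.norm_eq_abs]
      have n3 : ‖(q t : ℂ) * y.1‖ = |q t| * ‖y.1‖ := by
        rw [norm_mul, Complex.norm_real, Real.norm_eq_abs]
      refine norm_prod_le_iff.2 ⟨?_, ?_⟩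
      · refine (norm_sub_le _ _).trans ?_
        rw [n1]; nlinarith
      · refine (norm_add_le _ _).trans ?_
        rw [n2, n3]; nlinarith) hVi hx₀ (y₀, y₁)
  have hdiff : ∀ x ∈ Ioo a b, ∀ y ∈ Ioo a b, Y x = Y y + ∫ t in y..x, V t (Y t) := by
    intro x hx y hy
    rw [hY x hx, hY y hy, add_assoc, intervalIntegral.integral_add_adjacent_intervals
      (hVi Y hYc y hy x₀ hx₀) (hVi Y hYc x hx y hy)]
  refine ⟨fun x => (Y x).1, fun x => (Y x).2, ⟨?_, ?_⟩, ?_, ?_⟩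
  · intro x hx y hy
    simp only [ofReal_one, div_one]
    refine ⟨hi1 Y hYc x hx y hy, ?_⟩
    have h1 := (ContinuousLinearMap.fst ℝ ℂ ℂ).intervalIntegral_comp_comm (hVi Y hYc x hx y hy)
    have h2 := congrArg Prod.fst (hdiff x hx y hy)
    rw [Prod.fst_add] at h2
    rw [h2]; congr 1; exact h1.symm
  · intro x hx y hy
    simp only [zero_mul, mul_zero, sub_zero]
    refine ⟨hi2 Y hYc x hx y hy, ?_⟩
    have h1 := (ContinuousLinearMap.snd ℝ ℂ ℂ).intervalIntegral_comp_comm (hVi Y hYc x hx y hy)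
    have h2 := congrArg Prod.snd (hdiff x hx y hy)
    rw [Prod.snd_add] at h2
    rw [h2]; congr 1; exact h1.symm
  · simp [hY x₀ hx₀]
  · simp [hY x₀ hx₀]

abbrev Sys (a b : ℝ) (q s : ℝ → ℝ) (f fq w : ℝ → ℂ) : Prop :=
  SLSys a b (fun _ => 1) q (fun _ => 1) s f fq w

theorem sys_iff {a b : ℝ} {q s : ℝ → ℝ} {f fq w : ℝ → ℂ} :
    Sys a b q s f fq w ↔ ACD a b f (fun x => fq x - s x * f x) ∧
      ACD a b fq (fun x => s x * fq x + q x * f x - w x) := by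
  constructor
  · rintro ⟨h1, h2⟩
    simp only [ofReal_one, div_one, one_mul] at h1 h2
    exact ⟨h1.acd, h2.acd⟩
  · rintro ⟨h1, h2⟩
    constructor
    · simp only [ofReal_one, div_one]; exact h1.has
    · simp only [ofReal_one, one_mul]; exact h2.has

theorem transfer {a c : ℝ} {q₁ s₁ q₂ s₂ d : ℝ → ℝ} {f fq w : ℝ → ℂ}
    (hd : ACD a c (fun x => (d x : ℂ))
      (fun t => ((s₁ t ^ 2 - s₂ t ^ 2 + q₁ t - q₂ t : ℝ) : ℂ)))
    (hae : ∀ᵐ t, t ∈ Ioo a c → d t = s₁ t - s₂ t)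
    (h : Sys a c q₁ s₁ f fq w) : ∃ fq, Sys a c q₂ s₂ f fq w := by
  rw [sys_iff] at h
  obtain ⟨h1, h2⟩ := h
  refine ⟨fun x => fq x - d x * f x, ?_⟩
  rw [sys_iff]
  constructor
  · refine h1.congr (fun _ _ => rfl) ?_
    filter_upwards [hae] with t ht hm
    rw [ht hm]; push_cast; ring
  · refine (h2.sub (hd.mul h1)).congr (fun _ _ => rfl) ?_
    filter_upwards [hae] with t ht hm
    rw [ht hm]; push_cast; ring

theorem wr_const {a b : ℝ} {q s : ℝ → ℝ} {u uq v vq : ℝ → ℂ}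
    (hu : Sys a b q s u uq (fun x => 0 * u x)) (hv : Sys a b q s v vq (fun x => 0 * v x)) :
    ∀ x ∈ Ioo a b, ∀ y ∈ Ioo a b,
      u x * vq x - uq x * v x = u y * vq y - uq y * v y := by
  rw [sys_iff] at hu hv
  refine ((hu.1.mul hv.2).sub (hu.2.mul hv.1)).const_of_zero ?_
  exact Eventually.of_forall fun t _ => by ring

theorem extend {a b c x₀ : ℝ} {q s : ℝ → ℝ} {u uq φ φq ψ ψq : ℝ → ℂ} (hcb : c ≤ b)
    (hx₀ : x₀ ∈ Ioo a c)
    (hφ : Sys a b q s φ φq (fun x => 0 * φ x)) (hψ : Sys a b q s ψ ψq (fun x => 0 * ψ x))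
    (h1 : φ x₀ = 1) (h2 : φq x₀ = 0) (h3 : ψ x₀ = 0) (h4 : ψq x₀ = 1)
    (hu : Sys a c q s u uq (fun x => 0 * u x)) :
    ∃ v vq, Sys a b q s v vq (fun x => 0 * v x) ∧ ∀ x ∈ Ioo a c, u x = v x := by
  have hφ' : Sys a c q s φ φq (fun x => 0 * φ x) := by
    rw [sys_iff] at hφ ⊢; exact ⟨hφ.1.mono hcb, hφ.2.mono hcb⟩
  have hψ' : Sys a c q s ψ ψq (fun x => 0 * ψ x) := by
    rw [sys_iff] at hψ ⊢; exact ⟨hψ.1.mono hcb, hψ.2.mono hcb⟩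
  refine ⟨fun x => u x₀ * φ x + uq x₀ * ψ x, fun x => u x₀ * φq x + uq x₀ * ψq x, ?_, ?_⟩
  · rw [sys_iff] at hφ hψ ⊢
    constructor
    · refine (((ACD.const (u x₀)).mul hφ.1).add ((ACD.const (uq x₀)).mul hψ.1)).congr
        (fun _ _ => rfl) (Eventually.of_forall fun t _ => by ring)
    · refine (((ACD.const (u x₀)).mul hφ.2).add ((ACD.const (uq x₀)).mul hψ.2)).congr
        (fun _ _ => rfl) (Eventually.of_forall fun t _ => by ring)
  · intro x hx
    have e1 := wr_const hφ' hψ' x hx x₀ hx₀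
    have e2 := wr_const hu hψ' x hx x₀ hx₀
    have e3 := wr_const hu hφ' x hx x₀ hx₀
    simp only [h1, h2, h3, h4] at e1 e2 e3
    linear_combination (-u x) * e1 + φ x * e2 - ψ x * e3

theorem iInt_ofReal {P : ℝ → ℝ} {x y : ℝ} (h : IntervalIntegrable P volume y x) :
    IntervalIntegrable (fun t => (P t : ℂ)) volume y x := ⟨h.1.ofReal, h.2.ofReal⟩

theorem iInt_of_ofReal {P : ℝ → ℝ} {x y : ℝ}
    (h : IntervalIntegrable (fun t => (P t : ℂ)) volume y x) :
    IntervalIntegrable P volume y x := ⟨h.1.re, h.2.re⟩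

theorem acd_real {a c : ℝ} {d P : ℝ → ℝ}
    (h : ∀ x ∈ Ioo a c, ∀ y ∈ Ioo a c, IntervalIntegrable P volume y x ∧
      d x = d y + ∫ t in y..x, P t) :
    ACD a c (fun x => (d x : ℂ)) (fun x => (P x : ℂ)) := by
  refine HasACDeriv.acd fun x hx y hy => ⟨iInt_ofReal (h x hx y hy).1, ?_⟩
  rw [intervalIntegral.integral_ofReal, (h x hx y hy).2]
  push_cast; rfl

theorem ii_to_iii {a c : ℝ} {q₁ s₁ q₂ s₂ : ℝ → ℝ} {z₁ z₂ : ℂ} {u p₁ p₂ v r₁ r₂ : ℝ → ℂ}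
    (hu₁ : Sys a c q₁ s₁ u p₁ (fun x => z₁ * u x)) (hu₂ : Sys a c q₂ s₂ u p₂ (fun x => z₁ * u x))
    (hv₁ : Sys a c q₁ s₁ v r₁ (fun x => z₂ * v x)) (hv₂ : Sys a c q₂ s₂ v r₂ (fun x => z₂ * v x))
    (hne : ∀ x ∈ Ioo a c, u x ≠ 0 ∨ v x ≠ 0) :
    ∃ d : ℝ → ℝ,
        (∀ x ∈ Set.Ioo a c, ∀ y ∈ Set.Ioo a c,
          IntervalIntegrable (fun t => s₁ t ^ 2 - s₂ t ^ 2 + q₁ t - q₂ t) volume y x ∧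
          d x = d y + ∫ t in y..x, (s₁ t ^ 2 - s₂ t ^ 2 + q₁ t - q₂ t)) ∧
        (∀ᵐ t ∂(volume.restrict (Set.Ioo a c)), d t = s₁ t - s₂ t) := by
  rw [sys_iff] at hu₁ hu₂ hv₁ hv₂
  have hN := (hu₁.1.star.mul (hu₁.2.sub hu₂.2)).add (hv₁.1.star.mul (hv₁.2.sub hv₂.2))
  have hD := (hu₁.1.star.mul hu₁.1).add (hv₁.1.star.mul hv₁.1)
  have hD0 : ∀ x ∈ Ioo a c, conj (u x) * u x + conj (v x) * v x ≠ 0 := by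
    intro x hx h0
    rw [← normSq_eq_conj_mul_self, ← normSq_eq_conj_mul_self, ← ofReal_add] at h0
    have h1 := ofReal_eq_zero.1 h0
    have h2 := normSq_nonneg (u x)
    have h3 := normSq_nonneg (v x)
    rcases hne x hx with h | h
    · exact h (normSq_eq_zero.1 (by linarith))
    · exact h (normSq_eq_zero.1 (by linarith))
  have hu' := hu₁.1.uniq hu₂.1 (fun _ _ => rfl)
  have hv' := hv₁.1.uniq hv₂.1 (fun _ _ => rfl)
  have hd := hN.mul (hD.inv hD0)
  have hval : ∀ᵐ t, t ∈ Ioo a c → (conj (u t) * (p₁ t - p₂ t) + conj (v t) * (r₁ t - r₂ t)) *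
      (conj (u t) * u t + conj (v t) * v t)⁻¹ = ((s₁ t - s₂ t : ℝ) : ℂ) := by
    filter_upwards [hu', hv'] with t h1 h2 hm
    have h1 := h1 hm
    have h2 := h2 hm
    rw [mul_inv_eq_iff_eq_mul₀ (hD0 t hm)]
    push_cast
    linear_combination conj (u t) * h1 + conj (v t) * h2
  have hd2 := hd.congr (g' := fun t => ((s₁ t ^ 2 - s₂ t ^ 2 + q₁ t - q₂ t : ℝ) : ℂ))
    (fun _ _ => rfl) (by
      filter_upwards [hu', hv'] with t h1 h2 hm
      have h1 := h1 hm
      have h2 := h2 hm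
      have hd0 := hD0 t hm
      have e1 : p₁ t = p₂ t + (s₁ t - s₂ t) * u t := by linear_combination h1
      have e2 : r₁ t = r₂ t + (s₁ t - s₂ t) * v t := by linear_combination h2
      simp only [e1, e2]
      have hR := mul_inv_cancel₀ hd0
      generalize (conj (u t) * u t + conj (v t) * v t)⁻¹ = R at hR ⊢
      generalize conj (p₂ t + ((s₁ t : ℂ) - s₂ t) * u t - s₁ t * u t) = U'
      generalize conj (r₂ t + ((s₁ t : ℂ) - s₂ t) * v t - s₁ t * v t) = V'
      push_cast
      linear_combination (((s₁ t : ℂ) ^ 2 - s₂ t ^ 2 + q₁ t - q₂ t) - (s₁ t - s₂ t) *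
        (U' * u t + conj (u t) * (p₂ t - s₂ t * u t) + V' * v t
          + conj (v t) * (r₂ t - s₂ t * v t)) * R) * hR)
  refine ⟨fun x => ((conj (u x) * (p₁ x - p₂ x) + conj (v x) * (r₁ x - r₂ x)) *
      (conj (u x) * u x + conj (v x) * v x)⁻¹).re, fun x hx y hy => ?_, ?_⟩
  · obtain ⟨h1, h2⟩ := hd2.has x hx y hy
    refine ⟨iInt_of_ofReal h1, ?_⟩
    rw [intervalIntegral.integral_ofReal] at h2
    have h3 := congrArg Complex.re h2
    rw [add_re, ofReal_re] at h3
    exact h3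
  · rw [ae_restrict_iff' measurableSet_Ioo]
    filter_upwards [hval] with t ht hm
    rw [ht hm, ofReal_re]

theorem cycle_iff {A B C : Prop} (h1 : A → B) (h2 : B → C) (h3 : C → A) :
    (A ↔ B) ∧ (B ↔ C) := by tauto

theorem sys_mono {a b c : ℝ} {q s : ℝ → ℝ} {u uq w : ℝ → ℂ} (hcb : c ≤ b)
    (hu : Sys a b q s u uq w) : Sys a c q s u uq w := by
  rw [sys_iff] at hu ⊢
  exact ⟨hu.1.mono hcb, hu.2.mono hcb⟩

theorem sys_congr {a c : ℝ} {q s : ℝ → ℝ} {u v uq : ℝ → ℂ} {z : ℂ}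
    (h : ∀ x ∈ Ioo a c, v x = u x)
    (hu : Sys a c q s v uq (fun x => z * v x)) : Sys a c q s u uq (fun x => z * u x) := by
  rw [sys_iff] at hu ⊢
  exact ⟨hu.1.congr h (Eventually.of_forall fun t ht => by rw [h t ht]),
    hu.2.congr (fun _ _ => rfl) (Eventually.of_forall fun t ht => by rw [h t ht])⟩

/-- Characterization of when two Schrödinger-type expressions (`p = r = 1`) with
distributional potentials coincide on `(a,c)`. -/
theorem eq_tau_characterization {a b₁ b₂ c : ℝ} {q₁ s₁ q₂ s₂ : ℝ → ℝ}
    (hyp₁ : SLHyp a b₁ (fun _ => 1) q₁ (fun _ => 1) s₁)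
    (hyp₂ : SLHyp a b₂ (fun _ => 1) q₂ (fun _ => 1) s₂)
    (hc₁ : c ∈ Set.Ioo a b₁) (hc₂ : c ∈ Set.Ioo a b₂) :
    -- (i) ↔ (ii) and (ii) ↔ (iii) for:
    -- (i)  τ₁ and τ₂ are the same on (a,c)
    ((∀ f w : ℝ → ℂ,
        (∃ fq, SLSys a c (fun _ => 1) q₁ (fun _ => 1) s₁ f fq w) ↔
        (∃ fq, SLSys a c (fun _ => 1) q₂ (fun _ => 1) s₂ f fq w)) ↔
    -- (ii) matching solutions without common zeros
      (∃ z₁ z₂ : ℂ, ∃ u₁₁ u₁₁q u₁₂ u₁₂q u₂₁ u₂₁q u₂₂ u₂₂q : ℝ → ℂ,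
        SLSys a b₁ (fun _ => 1) q₁ (fun _ => 1) s₁ u₁₁ u₁₁q (fun x => z₁ * u₁₁ x) ∧
        SLSys a b₁ (fun _ => 1) q₁ (fun _ => 1) s₁ u₁₂ u₁₂q (fun x => z₂ * u₁₂ x) ∧
        SLSys a b₂ (fun _ => 1) q₂ (fun _ => 1) s₂ u₂₁ u₂₁q (fun x => z₁ * u₂₁ x) ∧
        SLSys a b₂ (fun _ => 1) q₂ (fun _ => 1) s₂ u₂₂ u₂₂q (fun x => z₂ * u₂₂ x) ∧
        (∀ x ∈ Set.Ioo a c, u₁₁ x = u₂₁ x) ∧ (∀ x ∈ Set.Ioo a c, u₁₂ x = u₂₂ x) ∧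
        (∀ x ∈ Set.Ioo a c, u₁₁ x ≠ 0 ∨ u₁₂ x ≠ 0) ∧
        (∀ x ∈ Set.Ioo a c, u₂₁ x ≠ 0 ∨ u₂₂ x ≠ 0))) ∧
    ((∃ z₁ z₂ : ℂ, ∃ u₁₁ u₁₁q u₁₂ u₁₂q u₂₁ u₂₁q u₂₂ u₂₂q : ℝ → ℂ,
        SLSys a b₁ (fun _ => 1) q₁ (fun _ => 1) s₁ u₁₁ u₁₁q (fun x => z₁ * u₁₁ x) ∧
        SLSys a b₁ (fun _ => 1) q₁ (fun _ => 1) s₁ u₁₂ u₁₂q (fun x => z₂ * u₁₂ x) ∧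
        SLSys a b₂ (fun _ => 1) q₂ (fun _ => 1) s₂ u₂₁ u₂₁q (fun x => z₁ * u₂₁ x) ∧
        SLSys a b₂ (fun _ => 1) q₂ (fun _ => 1) s₂ u₂₂ u₂₂q (fun x => z₂ * u₂₂ x) ∧
        (∀ x ∈ Set.Ioo a c, u₁₁ x = u₂₁ x) ∧ (∀ x ∈ Set.Ioo a c, u₁₂ x = u₂₂ x) ∧
        (∀ x ∈ Set.Ioo a c, u₁₁ x ≠ 0 ∨ u₁₂ x ≠ 0) ∧
        (∀ x ∈ Set.Ioo a c, u₂₁ x ≠ 0 ∨ u₂₂ x ≠ 0)) ↔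
    -- (iii) s₁ - s₂ is locally AC on (a,c) with (s₁-s₂)' = s₁² - s₂² + q₁ - q₂ a.e.
      (∃ d : ℝ → ℝ,
        (∀ x ∈ Set.Ioo a c, ∀ y ∈ Set.Ioo a c,
          IntervalIntegrable (fun t => s₁ t ^ 2 - s₂ t ^ 2 + q₁ t - q₂ t) volume y x ∧
          d x = d y + ∫ t in y..x, (s₁ t ^ 2 - s₂ t ^ 2 + q₁ t - q₂ t)) ∧
        (∀ᵐ t ∂(volume.restrict (Set.Ioo a c)), d t = s₁ t - s₂ t))) := by
  have hca := hc₁.1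
  refine cycle_iff ?_ ?_ ?_
  · intro hi
    obtain ⟨x₀, hx1, hx2⟩ := exists_between hca
    have m1 : x₀ ∈ Ioo a b₁ := ⟨hx1, hx2.trans hc₁.2⟩
    have m2 : x₀ ∈ Ioo a b₂ := ⟨hx1, hx2.trans hc₂.2⟩
    obtain ⟨u, uq, hu, hu0, hu1⟩ := exists_sol hyp₁ m1 1 0
    obtain ⟨v, vq, hv, hv0, hv1⟩ := exists_sol hyp₁ m1 0 1
    obtain ⟨φ, φq, hφ, hφ0, hφ1⟩ := exists_sol hyp₂ m2 1 0
    obtain ⟨ψ, ψq, hψ, hψ0, hψ1⟩ := exists_sol hyp₂ m2 0 1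
    have hne : ∀ x ∈ Ioo a c, u x ≠ 0 ∨ v x ≠ 0 := by
      intro x hx
      by_contra hcon
      push Not at hcon
      have := wr_const hu hv x ⟨hx.1, hx.2.trans hc₁.2⟩ x₀ m1
      rw [hcon.1, hcon.2, hu0, hu1, hv0, hv1] at this
      simp at this
    obtain ⟨uq', hu'⟩ := (hi u _).1 ⟨uq, sys_mono hc₁.2.le hu⟩
    obtain ⟨vq', hv'⟩ := (hi v _).1 ⟨vq, sys_mono hc₁.2.le hv⟩
    obtain ⟨u₂, u₂q, hu₂, eu⟩ := extend hc₂.2.le ⟨hx1, hx2⟩ hφ hψ hφ0 hφ1 hψ0 hψ1 hu'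
    obtain ⟨v₂, v₂q, hv₂, ev⟩ := extend hc₂.2.le ⟨hx1, hx2⟩ hφ hψ hφ0 hφ1 hψ0 hψ1 hv'
    exact ⟨0, 0, u, uq, v, vq, u₂, u₂q, v₂, v₂q, hu, hv, hu₂, hv₂, eu, ev, hne,
      fun x hx => by rw [← eu x hx, ← ev x hx]; exact hne x hx⟩
  · rintro ⟨z₁, z₂, u, uq, v, vq, u₂, u₂q, v₂, v₂q, hu, hv, hu₂, hv₂, eu, ev, hne, -⟩
    refine ii_to_iii (sys_mono hc₁.2.le hu)
      (sys_congr (fun x hx => (eu x hx).symm) (sys_mono hc₂.2.le hu₂))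
      (sys_mono hc₁.2.le hv)
      (sys_congr (fun x hx => (ev x hx).symm) (sys_mono hc₂.2.le hv₂)) hne
  · rintro ⟨d, hd, hae⟩ f w
    rw [ae_restrict_iff' measurableSet_Ioo] at hae
    have hd1 := acd_real hd
    constructor
    · rintro ⟨fq, h⟩
      exact transfer hd1 hae h
    · rintro ⟨fq, h⟩
      refine transfer (d := fun x => - d x) (((ACD.const 0).sub hd1).congr (fun x _ => ?_)
        (Eventually.of_forall fun t _ => ?_)) ?_ h
      · push_cast; ring
      · push_cast; ring
      · filter_upwards [hae] with t ht hm
        rw [ht hm]; ring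
end
end

section
/- Under the same hypotheses ($p=r=1$, $\tau$ regular at $a$, Dirichlet boundary condition $\varphi_a=0$ at $a$), the Neumann-type solution $\theta_z$ with $\theta_z(a)=1$, $\theta_z^{[1]}(a)=0$ satisfies $\theta_z(x) = \frac12 e^{\sqrt{-z}(x-a)}(1+o(1))$ and $\theta_z^{[1]}(x) = \frac{\sqrt{-z}}{2} e^{\sqrt{-z}(x-a)}(1+o(1))$ as $|z|\to\infty$ along any nonreal ray, for each fixed $x\in(a,b)$. -/
open MeasureTheory Set Filter Complex Topology ComplexConjugate

noncomputable section

/-- The branch `√(-z) = (-z)^{1/2}` of the square root with positive real part for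
`z` off the negative real axis. -/
def msqrt (z : ℂ) : ℂ := (-z) ^ (1 / 2 : ℂ)

/-- `(u, uq)` solves the system equivalent to `(τ - z) u = 0` (with `p = r = 1`,
`τ u = -(u' + s u)' + s (u' + s u) + q u`, quasi-derivative `uq = u' + s u`) on `[a,b)`
with the initial conditions `u(a) = d₁`, `u^{[1]}(a) = d₂` at the regular endpoint `a`. -/
structure RegSol (a b : ℝ) (q s : ℝ → ℝ) (z : ℂ) (u uq : ℝ → ℂ) (d₁ d₂ : ℂ) : Prop where
  fst : ∀ x ∈ Set.Ico a b,
    IntervalIntegrable (fun t => uq t - (s t : ℂ) * u t) volume a x ∧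
    u x = d₁ + ∫ t in a..x, (uq t - (s t : ℂ) * u t)
  snd : ∀ x ∈ Set.Ico a b,
    IntervalIntegrable (fun t => (s t : ℂ) * uq t + ((q t : ℂ) - z) * u t) volume a x ∧
    uq x = d₂ + ∫ t in a..x, ((s t : ℂ) * uq t + ((q t : ℂ) - z) * u t)

lemma ac_integral_complex {f : ℝ → ℂ} {a b : ℝ} (h : IntervalIntegrable f volume a b) :
    AbsolutelyContinuousOnInterval (fun x => ∫ t in a..x, f t) a b := by
  have hre : IntervalIntegrable (fun t => (f t).re) volume a b := ⟨h.1.re, h.2.re⟩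
  have him : IntervalIntegrable (fun t => (f t).im) volume a b := ⟨h.1.im, h.2.im⟩
  have c1 : AbsolutelyContinuousOnInterval (fun _ : ℝ => (1 : ℂ)) a b :=
    contDiffOn_const.absolutelyContinuousOnInterval
  have c2 : AbsolutelyContinuousOnInterval (fun _ : ℝ => Complex.I) a b :=
    contDiffOn_const.absolutelyContinuousOnInterval
  have key := ((hre.absolutelyContinuousOnInterval_intervalIntegral left_mem_uIcc).fun_smul c1).fun_add
    ((him.absolutelyContinuousOnInterval_intervalIntegral left_mem_uIcc).fun_smul c2)
  rw [absolutelyContinuousOnInterval_iff] at key ⊢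
  have heq : ∀ x ∈ uIcc a b, (∫ t in a..x, f t) =
      (∫ t in a..x, (f t).re) • (1 : ℂ) + (∫ t in a..x, (f t).im) • Complex.I := by
    intro x hx
    have hsub : IntervalIntegrable f volume a x := h.mono_set (uIcc_subset_uIcc_left hx)
    have h1 : IntervalIntegrable (fun t => (((f t).re : ℝ) : ℂ)) volume a x :=
      ⟨hsub.1.re.ofReal, hsub.2.re.ofReal⟩
    have h2 : IntervalIntegrable (fun t => (((f t).im : ℝ) : ℂ)) volume a x :=
      ⟨hsub.1.im.ofReal, hsub.2.im.ofReal⟩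
    have : (∫ t in a..x, f t) = ∫ t in a..x, ((((f t).re : ℝ) : ℂ) + (((f t).im : ℝ) : ℂ) * I) := by
      congr 1; ext t; exact (Complex.re_add_im _).symm
    rw [this, intervalIntegral.integral_add h1 (h2.mul_const _),
      intervalIntegral.integral_mul_const, intervalIntegral.integral_ofReal,
      intervalIntegral.integral_ofReal]
    simp
  intro ε hε
  obtain ⟨δ, hδ, H⟩ := key ε hε
  refine ⟨δ, hδ, fun E hE hlt => ?_⟩
  refine lt_of_eq_of_lt (Finset.sum_congr rfl fun i hi => ?_) (H E hE hlt)
  rw [heq _ (hE.1 i hi).1, heq _ (hE.1 i hi).2]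

lemma exp_mul_integral {a c : ℝ} (hac : a ≤ c) {U g : ℝ → ℂ} {d α : ℂ}
    (hg : IntervalIntegrable g volume a c)
    (hU : ∀ x ∈ Icc a c, U x = d + ∫ t in a..x, g t) :
    ∀ x ∈ Icc a c, Complex.exp (α * ((x : ℂ) - a)) * U x =
      d + ∫ t in a..x, Complex.exp (α * ((t : ℂ) - a)) * (α * U t + g t) := by
  have hu : uIcc a c = Icc a c := uIcc_of_le hac
  set V : ℝ → ℂ := fun x => d + ∫ t in a..x, g t with hV
  have hVac : AbsolutelyContinuousOnInterval V a c :=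
    AbsolutelyContinuousOnInterval.fun_add
      contDiffOn_const.absolutelyContinuousOnInterval (ac_integral_complex hg)
  set E : ℝ → ℂ := fun x => Complex.exp (α * ((x : ℂ) - a)) with hE
  have hEd : ∀ x : ℝ, HasDerivAt E (E x * α) x := by
    intro x
    have h1 : HasDerivAt (fun x : ℝ => α * ((x : ℂ) - a)) α x := by
      simpa using (((hasDerivAt_id x).ofReal_comp).sub_const (a : ℂ)).const_mul α
    exact h1.cexp
  have hEcd : ContDiff ℝ 1 E := by
    have : ContDiff ℝ 1 (fun x : ℝ => (x : ℂ)) := Complex.ofRealCLM.contDiff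
    exact (contDiff_const.mul (this.sub contDiff_const)).cexp
  have hEac : AbsolutelyContinuousOnInterval E a c :=
    hEcd.contDiffOn.absolutelyContinuousOnInterval
  set h : ℝ → ℂ := fun t => E t * (α * V t + g t) with hh
  have hint : IntervalIntegrable h volume a c := by
    refine IntervalIntegrable.continuousOn_mul ?_ hEcd.continuous.continuousOn
    exact (ContinuousOn.intervalIntegrable (hVac.continuousOn.const_smul α)).add hg
  have hF : AbsolutelyContinuousOnInterval (fun x => E x • V x - ∫ t in a..x, h t) a c :=
    AbsolutelyContinuousOnInterval.fun_sub (hEac.fun_smul hVac) (ac_integral_complex hint)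
  obtain ⟨K, hK⟩ := hF.const_of_ae_hasDerivAt_zero (by
    filter_upwards [hg.ae_hasDerivAt_integral, hint.ae_hasDerivAt_integral] with x h1 h2 hx
    have d1 := (h1 hx a left_mem_uIcc).const_add d
    have d2 := h2 hx a left_mem_uIcc
    have := ((hEd x).mul d1).sub d2
    simp only [smul_eq_mul]
    convert! this using 1
    simp only [hh, hV]; ring)
  intro x hx
  have e1 := hK a left_mem_uIcc
  have e2 := hK x (hu ▸ hx)
  have e3 : (∫ t in a..x, Complex.exp (α * ((t : ℂ) - a)) * (α * U t + g t)) = ∫ t in a..x, h t := by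
    apply intervalIntegral.integral_congr
    intro t ht
    rw [uIcc_of_le hx.1] at ht
    simp only [hh, hV, hE]
    rw [hU t ⟨ht.1, ht.2.trans hx.2⟩]
  have e4 : U x = V x := hU x hx
  rw [e3, e4]
  have eE : E a = 1 := by simp [hE]
  have eV : V a = d := by simp [hV]
  simp only [smul_eq_mul, intervalIntegral.integral_same, eE, eV] at e1 e2
  change E x * V x = _
  linear_combination e2 - e1

lemma gronwall_L1 {a c C : ℝ} (hac : a ≤ c) {f g : ℝ → ℝ} (hg0 : ∀ t, 0 ≤ g t)
    (hg : IntervalIntegrable g volume a c)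
    (hgf : IntervalIntegrable (fun t => g t * f t) volume a c)
    (hf : ∀ x ∈ Icc a c, f x ≤ C + ∫ t in a..x, g t * f t) :
    f c ≤ C * Real.exp (∫ t in a..c, g t) := by
  have hu : uIcc a c = Icc a c := uIcc_of_le hac
  have hG := hg.absolutelyContinuousOnInterval_intervalIntegral left_mem_uIcc
  have hE0 := hgf.absolutelyContinuousOnInterval_intervalIntegral left_mem_uIcc
  have hE : AbsolutelyContinuousOnInterval (fun x => C + ∫ t in a..x, g t * f t) a c :=
    AbsolutelyContinuousOnInterval.fun_add
      contDiffOn_const.absolutelyContinuousOnInterval hE0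
  have hexp : AbsolutelyContinuousOnInterval (fun x => Real.exp (-∫ t in a..x, g t)) a c := by
    rw [absolutelyContinuousOnInterval_iff] at hG ⊢
    intro ε hε
    obtain ⟨δ, hδ, H⟩ := hG ε hε
    refine ⟨δ, hδ, fun E hE hlt => ?_⟩
    refine lt_of_le_of_lt (Finset.sum_le_sum fun i hi => ?_) (H E hE hlt)
    have m1 := (hE.1 i hi).1
    have m2 := (hE.1 i hi).2
    rw [hu] at m1 m2
    have p1 : 0 ≤ ∫ t in a..(E.2 i).1, g t :=
      intervalIntegral.integral_nonneg m1.1 fun t _ => hg0 t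
    have p2 : 0 ≤ ∫ t in a..(E.2 i).2, g t :=
      intervalIntegral.integral_nonneg m2.1 fun t _ => hg0 t
    have aux : ∀ p r : ℝ, 0 ≤ p → 0 ≤ r → Real.exp (-p) - Real.exp (-r) ≤ |p - r| := by
      intro p r hp hr
      have h1 : Real.exp (-r) = Real.exp (-p) * Real.exp (p - r) := by
        rw [← Real.exp_add]; ring_nf
      have h2 := Real.add_one_le_exp (p - r)
      have h3 : Real.exp (-p) ≤ 1 := Real.exp_le_one_iff.2 (by linarith)
      have h4 := Real.exp_pos (-p)
      have h5 := neg_abs_le (p - r)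
      have h6 := abs_nonneg (p - r)
      rw [h1]
      nlinarith
    rw [Real.dist_eq, Real.dist_eq, abs_sub_le_iff]
    refine ⟨aux _ _ p1 p2, ?_⟩
    rw [abs_sub_comm]
    exact aux _ _ p2 p1
  have hH := (hE.fun_mul hexp)
  have hsub := hH.integral_deriv_eq_sub
  have hle : (∫ x in a..c, deriv (fun x => (C + ∫ t in a..x, g t * f t) *
      Real.exp (-∫ t in a..x, g t)) x) ≤ ∫ x in a..c, (0 : ℝ) := by
    apply intervalIntegral.integral_mono_ae_restrict hac hH.intervalIntegrable_deriv (by simp)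
    rw [EventuallyLE, ae_restrict_iff' measurableSet_Icc]
    filter_upwards [hg.ae_hasDerivAt_integral, hgf.ae_hasDerivAt_integral] with x h1 h2 hx
    have d1 := h1 (hu ▸ hx) a left_mem_uIcc
    have d2 := (h2 (hu ▸ hx) a left_mem_uIcc).const_add C
    have := (d2.mul d1.neg.exp).deriv
    simp only [Pi.mul_def, Pi.neg_apply] at this
    rw [this]
    have p := Real.exp_pos (-∫ t in a..x, g t)
    have := hf x hx
    have := mul_nonneg (mul_nonneg (hg0 x) p.le) (sub_nonneg.2 this)
    nlinarith
  rw [hsub] at hle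
  simp only [intervalIntegral.integral_same, intervalIntegral.integral_zero] at hle
  have h1 := hf c (right_mem_Icc.2 hac)
  have p := Real.exp_pos (∫ t in a..c, g t)
  refine h1.trans ?_
  rw [Real.exp_neg] at hle
  simp only [neg_zero, Real.exp_zero, add_zero, mul_one, sub_nonpos] at hle
  rwa [← div_eq_mul_inv, div_le_iff₀ p] at hle

lemma msqrt_sq (z : ℂ) : msqrt z ^ 2 = -z := by

  simp [msqrt]

lemma msqrt_ray {w : ℂ} {t : ℝ} (ht : 0 < t) (hw : w ≠ 0) :
    msqrt ((t : ℂ) * w) = (Real.sqrt t : ℂ) * msqrt w := by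
  unfold msqrt
  have : -((t : ℂ) * w) = (t : ℂ) * (-w) := by ring
  rw [this, Complex.cpow_def_of_ne_zero (by simp [ht.ne', hw]),
    Complex.cpow_def_of_ne_zero (by simp [hw]), Complex.log_ofReal_mul ht (by simp [hw]),
    add_mul, Complex.exp_add]
  congr 1
  rw [Real.sqrt_eq_rpow, Real.rpow_def_of_pos ht]
  push_cast
  rfl

lemma msqrt_re_pos {w : ℂ} (hw : w.im ≠ 0) : 0 < (msqrt w).re := by
  have hw0 : -w ≠ 0 := by
    intro h
    have : w = 0 := by simpa using h
    exact hw (by simp [this])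
  unfold msqrt
  rw [Complex.cpow_def_of_ne_zero hw0, Complex.exp_re]
  have him : (Complex.log (-w) * (1 / 2)).im = (-w).arg / 2 := by
    have : (1 / 2 : ℂ) = ((1 / 2 : ℝ) : ℂ) := by push_cast; rfl
    rw [this, Complex.im_mul_ofReal, Complex.log_im]; ring
  rw [him]
  apply mul_pos (Real.exp_pos _)
  apply Real.cos_pos_of_mem_Ioo
  have h1 := Complex.neg_pi_lt_arg (-w)
  have h2 := Complex.arg_le_pi (-w)
  have h3 : (-w).arg ≠ Real.pi := by
    intro h
    rw [Complex.arg_eq_pi_iff] at h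
    exact hw (by simpa using h.2)
  have := lt_of_le_of_ne h2 h3
  constructor <;> linarith

/-- The diagonalised integral system. -/
structure PQSys (a c : ℝ) (q s : ℝ → ℝ) (k : ℂ) (P Q : ℝ → ℂ) : Prop where
  contP : ContinuousOn P (Icc a c)
  contQ : ContinuousOn Q (Icc a c)
  eqP : ∀ y ∈ Icc a c, P y = 1 + ∫ t in a..y, (-(s t : ℂ) * Q t + (q t : ℂ) / (2 * k) * (P t + Q t))
  eqQ : ∀ y ∈ Icc a c, Q y = Complex.exp (-2 * k * ((y : ℂ) - a)) +
    ∫ t in a..y, Complex.exp (-2 * k * ((y : ℂ) - t)) *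
      (-(s t : ℂ) * P t - (q t : ℂ) / (2 * k) * (P t + Q t))

lemma pqsys_of_sol {a b c : ℝ} (hac : a ≤ c) (hcb : c < b) {q s : ℝ → ℝ} {z k : ℂ} (hk : k ≠ 0)
    (hkz : k ^ 2 = -z) {u v : ℝ → ℂ} (h : RegSol a b q s z u v 1 0) :
    PQSys a c q s k (fun y => Complex.exp (-k * ((y : ℂ) - a)) * (u y + v y / k))
      (fun y => Complex.exp (-k * ((y : ℂ) - a)) * (u y - v y / k)) := by
  obtain ⟨i1, -⟩ := h.fst c ⟨hac, hcb⟩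
  obtain ⟨i2, -⟩ := h.snd c ⟨hac, hcb⟩
  have hu : uIcc a c = Icc a c := uIcc_of_le hac
  have e1 : ∀ y ∈ Icc a c, u y = 1 + ∫ t in a..y, (v t - (s t : ℂ) * u t) :=
    fun y hy => (h.fst y ⟨hy.1, hy.2.trans_lt hcb⟩).2
  have e2 : ∀ y ∈ Icc a c, v y = 0 + ∫ t in a..y, ((s t : ℂ) * v t + ((q t : ℂ) - z) * u t) :=
    fun y hy => (h.snd y ⟨hy.1, hy.2.trans_lt hcb⟩).2
  have cu : ContinuousOn u (Icc a c) :=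
    ContinuousOn.congr (f := fun y => 1 + ∫ t in a..y, (v t - (s t : ℂ) * u t))
      (by rw [← hu]; exact continuousOn_const.add (ac_integral_complex i1).continuousOn) e1
  have cv : ContinuousOn v (Icc a c) :=
    ContinuousOn.congr (f := fun y => 0 + ∫ t in a..y, ((s t : ℂ) * v t + ((q t : ℂ) - z) * u t))
      (by rw [← hu]; exact continuousOn_const.add (ac_integral_complex i2).continuousOn) e2
  have ce : ContinuousOn (fun y : ℝ => Complex.exp (-k * ((y : ℂ) - a))) (Icc a c) := by
    apply Continuous.continuousOn; fun_prop
  have j1 : ∀ y ∈ Icc a c, IntervalIntegrable (fun t => v t - (s t : ℂ) * u t) volume a y :=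
    fun y hy => (h.fst y ⟨hy.1, hy.2.trans_lt hcb⟩).1
  have j2 : ∀ y ∈ Icc a c,
      IntervalIntegrable (fun t => (s t : ℂ) * v t + ((q t : ℂ) - z) * u t) volume a y :=
    fun y hy => (h.snd y ⟨hy.1, hy.2.trans_lt hcb⟩).1
  have ep : ∀ y ∈ Icc a c, u y + v y / k = 1 + ∫ t in a..y, ((v t - (s t : ℂ) * u t) +
      ((s t : ℂ) * v t + ((q t : ℂ) - z) * u t) / k) := by
    intro y hy
    rw [intervalIntegral.integral_add (j1 y hy) ((j2 y hy).div_const k),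
      intervalIntegral.integral_div, e1 y hy, e2 y hy]
    ring
  have em : ∀ y ∈ Icc a c, u y - v y / k = 1 + ∫ t in a..y, ((v t - (s t : ℂ) * u t) -
      ((s t : ℂ) * v t + ((q t : ℂ) - z) * u t) / k) := by
    intro y hy
    rw [intervalIntegral.integral_sub (j1 y hy) ((j2 y hy).div_const k),
      intervalIntegral.integral_div, e1 y hy, e2 y hy]
    ring
  have hz : z = -k ^ 2 := by rw [hkz]; ring
  refine ⟨ce.mul (cu.add (cv.div_const k)), ce.mul (cu.sub (cv.div_const k)), ?_, ?_⟩
  · intro y hy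
    rw [exp_mul_integral (α := -k) hac (i1.add (i2.div_const k)) ep y hy]
    congr 2
    ext t
    rw [hz]
    field_simp
    ring
  · intro y hy
    have := exp_mul_integral (α := k) hac (i1.sub (i2.div_const k)) em y hy
    have h1 : Complex.exp (-k * ((y : ℂ) - a)) =
        Complex.exp (-2 * k * ((y : ℂ) - a)) * Complex.exp (k * ((y : ℂ) - a)) := by
      rw [← Complex.exp_add]; ring_nf
    rw [h1, mul_assoc, this, mul_add, mul_one, ← intervalIntegral.integral_const_mul]
    congr 2
    ext t
    have h2 : Complex.exp (-2 * k * ((y : ℂ) - a)) * Complex.exp (k * ((t : ℂ) - a)) =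
        Complex.exp (-2 * k * ((y : ℂ) - t)) * Complex.exp (-k * ((t : ℂ) - a)) := by
      rw [← Complex.exp_add, ← Complex.exp_add]; ring_nf
    rw [← mul_assoc, h2, hz]
    field_simp
    ring

lemma norm_exp_le_one {k : ℂ} (hk : 0 ≤ k.re) {y t : ℝ} (h : t ≤ y) :
    ‖Complex.exp (-2 * k * ((y : ℂ) - t))‖ ≤ 1 := by
  rw [Complex.norm_exp]
  apply Real.exp_le_one_iff.2
  have : (-2 * k * ((y : ℂ) - t)).re = -2 * k.re * (y - t) := by
    simp
  rw [this]
  nlinarith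

lemma norm_exp_eq {k : ℂ} {y t : ℝ} :
    ‖Complex.exp (-2 * k * ((y : ℂ) - t))‖ = Real.exp (-2 * k.re * (y - t)) := by
  rw [Complex.norm_exp]
  congr 1
  simp

lemma norm_q_div {k : ℂ} (hk : 1 ≤ ‖k‖) (r : ℝ) : ‖(r : ℂ) / (2 * k)‖ ≤ |r| / 2 := by
  rw [norm_div, norm_mul, Complex.norm_real, Real.norm_eq_abs]
  simp only [Complex.norm_ofNat]
  gcongr
  linarith

lemma pqsys_bound {a c : ℝ} {q s : ℝ → ℝ} (hq : IntervalIntegrable q volume a c)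
    (hs : IntervalIntegrable s volume a c) {k : ℂ} {P Q : ℝ → ℂ} (h : PQSys a c q s k P Q)
    (hk0 : 0 ≤ k.re) (hk1 : 1 ≤ ‖k‖) :
    ∀ y ∈ Icc a c, ‖P y‖ + ‖Q y‖ ≤ 2 * Real.exp (∫ t in a..c, (|s t| + |q t|)) := by
  have hcN : ContinuousOn (fun t => ‖P t‖ + ‖Q t‖) (Icc a c) := h.contP.norm.add h.contQ.norm
  have sub : ∀ y ∈ Icc a c, uIcc a y ⊆ uIcc a c := by
    intro y hy
    rw [uIcc_of_le hy.1, uIcc_of_le (hy.1.trans hy.2)]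
    exact Icc_subset_Icc_right hy.2
  have hg : IntervalIntegrable (fun t => |s t| + |q t|) volume a c := hs.abs.add hq.abs
  intro y hy
  have hsubI : uIcc a y ⊆ Icc a c := by
    rw [uIcc_of_le hy.1]; exact Icc_subset_Icc_right hy.2
  have hgy : IntervalIntegrable (fun t => |s t| + |q t|) volume a y := hg.mono_set (sub y hy)
  have step : (fun t => ‖P t‖ + ‖Q t‖) y ≤ 2 * Real.exp (∫ t in a..y, (|s t| + |q t|)) := by
    refine gronwall_L1 hy.1 (fun t => by positivity) hgy
      (hgy.mul_continuousOn (hcN.mono hsubI)) ?_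
    intro x hx
    have hx' : x ∈ Icc a c := ⟨hx.1, hx.2.trans hy.2⟩
    have hsubx : uIcc a x ⊆ Icc a c := by
      rw [uIcc_of_le hx.1]; exact Icc_subset_Icc_right hx'.2
    have hsx := hs.abs.mono_set (sub x hx')
    have hqx := hq.abs.mono_set (sub x hx')
    have iP : IntervalIntegrable (fun t => |s t| * ‖Q t‖ + |q t| / 2 * (‖P t‖ + ‖Q t‖)) volume a x :=
      (hsx.mul_continuousOn (h.contQ.norm.mono hsubx)).add
        ((hqx.div_const 2).mul_continuousOn (hcN.mono hsubx))
    have iQ : IntervalIntegrable (fun t => |s t| * ‖P t‖ + |q t| / 2 * (‖P t‖ + ‖Q t‖)) volume a x :=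
      (hsx.mul_continuousOn (h.contP.norm.mono hsubx)).add
        ((hqx.div_const 2).mul_continuousOn (hcN.mono hsubx))
    have bP : ‖P x‖ ≤ 1 + ∫ t in a..x, (|s t| * ‖Q t‖ + |q t| / 2 * (‖P t‖ + ‖Q t‖)) := by
      rw [h.eqP x hx']
      refine (norm_add_le _ _).trans ?_
      rw [norm_one]
      gcongr
      refine intervalIntegral.norm_integral_le_of_norm_le hx.1 (ae_of_all _ fun t _ => ?_) iP
      refine (norm_add_le _ _).trans ?_
      rw [norm_mul, norm_mul, norm_neg, Complex.norm_real, Real.norm_eq_abs]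
      gcongr
      · exact norm_q_div hk1 _
      · exact norm_add_le _ _
    have bQ : ‖Q x‖ ≤ 1 + ∫ t in a..x, (|s t| * ‖P t‖ + |q t| / 2 * (‖P t‖ + ‖Q t‖)) := by
      rw [h.eqQ x hx']
      refine (norm_add_le _ _).trans ?_
      refine add_le_add (norm_exp_le_one hk0 hx.1) ?_
      refine intervalIntegral.norm_integral_le_of_norm_le hx.1 (ae_of_all _ fun t ht => ?_) iQ
      rw [norm_mul]
      refine (mul_le_of_le_one_left (norm_nonneg _) (norm_exp_le_one hk0 ht.2)).trans ?_
      refine (norm_sub_le _ _).trans ?_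
      rw [norm_mul, norm_mul, norm_neg, Complex.norm_real, Real.norm_eq_abs]
      gcongr
      · exact norm_q_div hk1 _
      · exact norm_add_le _ _
    have hsum := intervalIntegral.integral_add iP iQ
    have hcongr : (∫ t in a..x, ((|s t| * ‖Q t‖ + |q t| / 2 * (‖P t‖ + ‖Q t‖)) +
        (|s t| * ‖P t‖ + |q t| / 2 * (‖P t‖ + ‖Q t‖)))) =
        ∫ t in a..x, (|s t| + |q t|) * (‖P t‖ + ‖Q t‖) := by
      congr 1; ext t; ring
    rw [hcongr] at hsum
    change ‖P x‖ + ‖Q x‖ ≤ _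
    rw [hsum]
    linarith
  refine step.trans ?_
  gcongr
  refine intervalIntegral.integral_mono_interval le_rfl hy.1 hy.2 ?_ hg
  exact ae_of_all _ fun t => by simp only [Pi.zero_apply]; positivity

lemma pqsys_tendsto {a c : ℝ} (hac : a < c) {q s : ℝ → ℝ} (hq : IntervalIntegrable q volume a c)
    (hs : IntervalIntegrable s volume a c) {k : ℝ → ℂ} {P Q : ℝ → ℝ → ℂ}
    (h : ∀ᶠ n in atTop, PQSys a c q s (k n) (P n) (Q n))
    (hk : Tendsto (fun n => (k n).re) atTop atTop) :
    Tendsto (fun n => P n c) atTop (𝓝 1) ∧ Tendsto (fun n => Q n c) atTop (𝓝 0) := by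
  set C : ℝ := 2 * Real.exp (∫ t in a..c, (|s t| + |q t|)) with hC
  have hC0 : 0 ≤ C := by positivity
  have hkn : Tendsto (fun n => ‖k n‖) atTop atTop :=
    tendsto_atTop_mono (fun n => Complex.re_le_norm _) hk
  have good : ∀ᶠ n in atTop, PQSys a c q s (k n) (P n) (Q n) ∧ 0 ≤ (k n).re ∧ 1 ≤ ‖k n‖ ∧
      ∀ y ∈ Icc a c, ‖P n y‖ + ‖Q n y‖ ≤ C := by
    filter_upwards [h, hk.eventually_ge_atTop 0, hkn.eventually_ge_atTop 1] with n h1 h2 h3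
    exact ⟨h1, h2, h3, pqsys_bound hq hs h1 h2 h3⟩
  have hqterm : Tendsto (fun n => (∫ t in a..c, |q t|) * C * ‖k n‖⁻¹) atTop (𝓝 0) := by
    simpa using (tendsto_inv_atTop_zero.comp hkn).const_mul ((∫ t in a..c, |q t|) * C)
  have normq : ∀ (κ : ℂ) (r : ℝ), ‖(r : ℂ) / (2 * κ)‖ ≤ |r| * ‖κ‖⁻¹ := by
    intro κ r
    rw [norm_div, norm_mul, Complex.norm_real, Real.norm_eq_abs, div_eq_mul_inv, mul_inv]
    simp only [Complex.norm_ofNat]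
    have : 0 ≤ ‖κ‖⁻¹ := by positivity
    gcongr
    linarith
  have hQ : ∀ y ∈ Ioc a c, Tendsto (fun n => Q n y) atTop (𝓝 0) := by
    intro y hy
    have hy' : y ∈ Icc a c := ⟨hy.1.le, hy.2⟩
    have sub : uIcc a y ⊆ uIcc a c := by
      rw [uIcc_of_le hy.1.le, uIcc_of_le hac.le]
      exact Icc_subset_Icc_right hy.2
    have hsy := hs.abs.mono_set sub
    have hqy := hq.abs.mono_set sub
    have lim1 : ∀ t < y, Tendsto (fun n => Real.exp (-2 * (k n).re * (y - t))) atTop (𝓝 0) := by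
      intro t ht
      apply Real.tendsto_exp_atBot.comp
      have : Tendsto (fun n => (k n).re * (-2 * (y - t))) atTop atBot :=
        hk.atTop_mul_const_of_neg (by linarith)
      refine this.congr fun n => by ring
    have lim2 : Tendsto (fun n => ∫ t in a..y, Real.exp (-2 * (k n).re * (y - t)) * |s t|)
        atTop (𝓝 (∫ t in a..y, (0 : ℝ))) := by
      refine intervalIntegral.tendsto_integral_filter_of_dominated_convergence (fun t => |s t|)
        ?_ ?_ hsy ?_
      · refine Eventually.of_forall fun n => ?_
        refine AEStronglyMeasurable.mul ?_ (intervalIntegrable_iff.1 hsy).aestronglyMeasurable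
        exact Continuous.aestronglyMeasurable (by fun_prop)
      · filter_upwards [good] with n hn
        refine ae_of_all _ fun t ht => ?_
        rw [uIoc_of_le hy.1.le] at ht
        rw [norm_mul, Real.norm_eq_abs, Real.norm_eq_abs, abs_abs, Real.abs_exp]
        refine mul_le_of_le_one_left (abs_nonneg _) (Real.exp_le_one_iff.2 ?_)
        nlinarith [hn.2.1, ht.2]
      · have : ∀ᵐ t : ℝ, t ≠ y := by simp [ae_iff, measure_singleton]
        filter_upwards [this] with t hty ht
        rw [uIoc_of_le hy.1.le] at ht
        simpa using (lim1 t (lt_of_le_of_ne ht.2 hty)).mul_const |s t|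
    have lim3 : Tendsto (fun n => Real.exp (-2 * (k n).re * (y - a)) +
        (C * (∫ t in a..y, Real.exp (-2 * (k n).re * (y - t)) * |s t|) +
          (∫ t in a..c, |q t|) * C * ‖k n‖⁻¹)) atTop (𝓝 0) := by
      simpa using (lim1 a hy.1).add ((lim2.const_mul C).add hqterm)
    refine squeeze_zero_norm' ?_ lim3
    filter_upwards [good] with n hn
    obtain ⟨hS, hre, h1, hb⟩ := hn
    rw [hS.eqQ y hy']
    refine (norm_add_le _ _).trans ?_
    rw [norm_exp_eq]
    gcongr
    have i1 : IntervalIntegrable (fun t => Real.exp (-2 * (k n).re * (y - t)) * |s t|) volume a y :=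
      hsy.continuousOn_mul (Continuous.continuousOn (by fun_prop))
    have hle := intervalIntegral.norm_integral_le_of_norm_le (μ := volume) hy.1.le
      (f := fun t => Complex.exp (-2 * k n * ((y : ℂ) - t)) *
        (-(s t : ℂ) * P n t - (q t : ℂ) / (2 * k n) * (P n t + Q n t)))
      (g := fun t => C * (Real.exp (-2 * (k n).re * (y - t)) * |s t|) + |q t| * (C * ‖k n‖⁻¹))
      (ae_of_all _ fun t ht => by
        have htI : t ∈ Icc a c := ⟨ht.1.le, ht.2.trans hy.2⟩
        have hbt := hb t htI
        have hP : ‖P n t‖ ≤ C := by linarith [norm_nonneg (Q n t)]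
        rw [mul_sub]
        refine (norm_sub_le _ _).trans (add_le_add ?_ ?_)
        · rw [norm_mul, norm_mul, norm_neg, Complex.norm_real, Real.norm_eq_abs, norm_exp_eq]
          have : 0 ≤ Real.exp (-2 * (k n).re * (y - t)) * |s t| := by positivity
          nlinarith
        · rw [norm_mul]
          refine (mul_le_of_le_one_left (norm_nonneg _) (norm_exp_le_one hre ht.2)).trans ?_
          rw [norm_mul]
          calc _ ≤ (|q t| * ‖k n‖⁻¹) * C :=
                mul_le_mul (normq _ _) ((norm_add_le _ _).trans hbt) (norm_nonneg _) (by positivity)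
            _ = _ := by ring)
      ((i1.const_mul C).add (hqy.mul_const _))
    refine hle.trans ?_
    rw [intervalIntegral.integral_add (i1.const_mul C) (hqy.mul_const _),
      intervalIntegral.integral_const_mul, intervalIntegral.integral_mul_const]
    have mono : (∫ t in a..y, |q t|) ≤ ∫ t in a..c, |q t| :=
      intervalIntegral.integral_mono_interval le_rfl hy.1.le hy.2
        (ae_of_all _ fun t => abs_nonneg _) hq.abs
    have : 0 ≤ C * ‖k n‖⁻¹ := by positivity
    nlinarith [mul_le_mul_of_nonneg_right mono this]
  refine ⟨?_, hQ c ⟨hac, le_rfl⟩⟩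
  have lim2 : Tendsto (fun n => ∫ t in a..c, |s t| * ‖Q n t‖) atTop (𝓝 (∫ t in a..c, (0 : ℝ))) := by
    refine intervalIntegral.tendsto_integral_filter_of_dominated_convergence (fun t => |s t| * C)
      ?_ ?_ (hs.abs.mul_const C) ?_
    · filter_upwards [good] with n hn
      have : IntervalIntegrable (fun t => |s t| * ‖Q n t‖) volume a c :=
        hs.abs.mul_continuousOn (by rw [uIcc_of_le hac.le]; exact hn.1.contQ.norm)
      exact (intervalIntegrable_iff.1 this).aestronglyMeasurable
    · filter_upwards [good] with n hn
      refine ae_of_all _ fun t ht => ?_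
      rw [uIoc_of_le hac.le] at ht
      have := hn.2.2.2 t ⟨ht.1.le, ht.2⟩
      rw [norm_mul, Real.norm_eq_abs, Real.norm_eq_abs, abs_abs, abs_norm]
      gcongr
      linarith [norm_nonneg (P n t)]
    · refine ae_of_all _ fun t ht => ?_
      rw [uIoc_of_le hac.le] at ht
      simpa using (hQ t ht).norm.const_mul |s t|
  have lim3 : Tendsto (fun n => (∫ t in a..c, |s t| * ‖Q n t‖) +
      (∫ t in a..c, |q t|) * C * ‖k n‖⁻¹) atTop (𝓝 0) := by
    simpa using lim2.add hqterm
  rw [tendsto_iff_norm_sub_tendsto_zero]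
  refine squeeze_zero' (Eventually.of_forall fun n => norm_nonneg _) ?_ lim3
  filter_upwards [good] with n hn
  obtain ⟨hS, hre, h1, hb⟩ := hn
  rw [hS.eqP c ⟨hac.le, le_rfl⟩, add_sub_cancel_left]
  have i1 : IntervalIntegrable (fun t => |s t| * ‖Q n t‖) volume a c :=
    hs.abs.mul_continuousOn (by rw [uIcc_of_le hac.le]; exact hS.contQ.norm)
  have hle := intervalIntegral.norm_integral_le_of_norm_le (μ := volume) hac.le
    (f := fun t => -(s t : ℂ) * Q n t + (q t : ℂ) / (2 * k n) * (P n t + Q n t))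
    (g := fun t => |s t| * ‖Q n t‖ + |q t| * (C * ‖k n‖⁻¹))
    (ae_of_all _ fun t ht => by
      have hbt := hb t ⟨ht.1.le, ht.2⟩
      refine (norm_add_le _ _).trans (add_le_add ?_ ?_)
      · rw [norm_mul, norm_neg, Complex.norm_real, Real.norm_eq_abs]
      · rw [norm_mul]
        calc _ ≤ (|q t| * ‖k n‖⁻¹) * C :=
              mul_le_mul (normq _ _) ((norm_add_le _ _).trans hbt) (norm_nonneg _) (by positivity)
          _ = _ := by ring)
    (i1.add (hq.abs.mul_const _))
  refine hle.trans ?_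
  rw [intervalIntegral.integral_add i1 (hq.abs.mul_const _), intervalIntegral.integral_mul_const]
  exact le_of_eq (by ring)

/-- High-energy asymptotics of the Neumann-type solution `θ_z` (with `θ_z(a) = 1`,
`θ_z^{[1]}(a) = 0`): `θ_z(x) = ½ e^{√(-z)(x-a)} (1+o(1))` and
`θ_z^{[1]}(x) = (√(-z)/2) e^{√(-z)(x-a)} (1+o(1))` as `|z| → ∞` along any nonreal ray. -/
theorem neumann_solution_asymptotics {a b : ℝ} (hab : a < b) {q s : ℝ → ℝ}
    (hq : ∀ x ∈ Set.Ioo a b, IntervalIntegrable q volume a x)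
    (hs : ∀ x ∈ Set.Ioo a b, IntervalIntegrable s volume a x)
    {θ θq : ℂ → ℝ → ℂ} (hθ : ∀ z : ℂ, RegSol a b q s z (θ z) (θq z) 1 0)
    {x : ℝ} (hx : x ∈ Set.Ioo a b) {w : ℂ} (hw : w.im ≠ 0) :
    Tendsto (fun t : ℝ => θ ((t : ℂ) * w) x * 2 *
        Complex.exp (-(msqrt ((t : ℂ) * w)) * ((x : ℂ) - (a : ℂ)))) atTop (𝓝 1) ∧
    Tendsto (fun t : ℝ => θq ((t : ℂ) * w) x * (2 / msqrt ((t : ℂ) * w)) *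
        Complex.exp (-(msqrt ((t : ℂ) * w)) * ((x : ℂ) - (a : ℂ)))) atTop (𝓝 1) := by

  have hw0 : w ≠ 0 := by
    intro h
    exact hw (by simp [h])
  have hkre : Tendsto (fun t : ℝ => (msqrt ((t : ℂ) * w)).re) atTop atTop := by
    have h1 : Tendsto (fun t : ℝ => Real.sqrt t * (msqrt w).re) atTop atTop :=
      Real.tendsto_sqrt_atTop.atTop_mul_const (msqrt_re_pos hw)
    refine h1.congr' ?_
    filter_upwards [eventually_gt_atTop 0] with t ht
    rw [msqrt_ray ht hw0, Complex.re_ofReal_mul]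
  have hne : ∀ᶠ t : ℝ in atTop, msqrt ((t : ℂ) * w) ≠ 0 := by
    filter_upwards [hkre.eventually_gt_atTop 0] with t ht h0
    rw [h0] at ht
    simp at ht
  obtain ⟨hP, hQ⟩ := pqsys_tendsto hx.1 (hq x hx) (hs x hx)
    (k := fun t => msqrt ((t : ℂ) * w))
    (P := fun t y => Complex.exp (-msqrt ((t : ℂ) * w) * ((y : ℂ) - a)) *
      (θ ((t : ℂ) * w) y + θq ((t : ℂ) * w) y / msqrt ((t : ℂ) * w)))
    (Q := fun t y => Complex.exp (-msqrt ((t : ℂ) * w) * ((y : ℂ) - a)) *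
      (θ ((t : ℂ) * w) y - θq ((t : ℂ) * w) y / msqrt ((t : ℂ) * w)))
    (by
      filter_upwards [hne] with t ht
      exact pqsys_of_sol hx.1.le hx.2 ht (msqrt_sq _) (hθ _)) hkre
  constructor
  · have := hP.add hQ
    rw [add_zero] at this
    refine this.congr fun t => ?_
    ring
  · have := hP.sub hQ
    rw [sub_zero] at this
    refine this.congr fun t => ?_
    ring
end
end
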